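/- Let A, B, C, D be points in the Euclidean plane with A ≠ B, such that A, B, C are affinely independent, A, B, D are affinely independent, and C and D lie strictly on opposite sides of the line through A and B. Then the segment joining the incenter of triangle ABC and the incenter of triangle ABD intersects the open segment between A and B. -/

import Mathlib

/-- The incenter of the triangle with vertices `A`, `B`, `C` in the Euclidean
plane: the barycentric combination of the vertices weighted by the lengths of
the opposite sides. -/
noncomputable def incenter (A B C : EuclideanSpace ℝ (Fin 2)) :
    EuclideanSpace ℝ (Fin 2) :=
  (dist B C / (dist B C + dist C A + dist A B)) • A +
  (dist C A / (dist B C + dist C A + dist A B)) • B +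
  (dist A B / (dist B C + dist C A + dist A B)) • C

open AffineSubspace in
/-- The incenter of `ABC` lies strictly on the same side of the line `AB` as `C`. -/
theorem sSameSide_incenter {A B C : EuclideanSpace ℝ (Fin 2)} (hAB : A ≠ B)
    (hC : C ∉ affineSpan ℝ {A, B}) :
    (affineSpan ℝ {A, B}).SSameSide C (incenter A B C) := by
  have hc : 0 < dist A B := dist_pos.2 hAB
  have hp : 0 < dist B C + dist C A + dist A B := by positivity
  have hA : A ∈ affineSpan ℝ {A, B} := left_mem_affineSpan_pair ℝ A B
  have hsum : incenter A B C =
      (dist A B / (dist B C + dist C A + dist A B)) • (C -ᵥ A) +ᵥ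
        AffineMap.lineMap A B (dist C A / (dist B C + dist C A + dist A B)) := by
    have ha : dist B C / (dist B C + dist C A + dist A B) =
        1 - dist C A / (dist B C + dist C A + dist A B)
          - dist A B / (dist B C + dist C A + dist A B) := by
      field_simp
      ring
    rw [incenter, ha, AffineMap.lineMap_apply]
    simp only [vsub_eq_sub, vadd_eq_add]
    module
  rw [hsum]
  exact (sSameSide_smul_vsub_vadd_left hC hA
    (AffineMap.lineMap_mem_affineSpan_pair _ A B) (div_pos hc hp)).symm

/-- The scalar product of `AI` and `AB`, for `I` the incenter of `ABC`, is `AB` times the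
tangent length from `A` to the incircle. -/
theorem inner_incenter_sub {A B : EuclideanSpace ℝ (Fin 2)} (C : EuclideanSpace ℝ (Fin 2))
    (hAB : A ≠ B) :
    inner ℝ (incenter A B C - A) (B - A) =
      dist A B * (dist C A + dist A B - dist B C) / 2 := by
  have hc : 0 < dist A B := dist_pos.2 hAB
  have hp : 0 < dist B C + dist C A + dist A B := by positivity
  have hsum : incenter A B C - A =
      (dist B C + dist C A + dist A B)⁻¹ • (dist C A • (B - A) + dist A B • (C - A)) := by
    have ha : dist B C / (dist B C + dist C A + dist A B) =
        1 - dist C A / (dist B C + dist C A + dist A B)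
          - dist A B / (dist B C + dist C A + dist A B) := by
      field_simp
      ring
    rw [incenter, ha]
    module
  have hlaw : dist B C ^ 2 = dist C A ^ 2 - 2 * inner ℝ (C - A) (B - A) + dist A B ^ 2 := by
    rw [dist_comm B C, dist_comm A B, dist_eq_norm, dist_eq_norm, dist_eq_norm,
      ← norm_sub_sq_real, sub_sub_sub_cancel_right]
  have hself : inner ℝ (B - A) (B - A) = dist A B ^ 2 := by
    rw [real_inner_self_eq_norm_sq, dist_comm, dist_eq_norm]
  rw [hsum, real_inner_smul_left, inner_add_left, real_inner_smul_left, real_inner_smul_left,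
    hself]
  field_simp
  linear_combination hlaw

/-- The orthogonal projection of the incenter of `ABC` onto `AB` lies strictly between `A`
and `B`. -/
theorem inner_incenter_sub_mem_Ioo {A B C : EuclideanSpace ℝ (Fin 2)} (hAB : A ≠ B)
    (hC : C ∉ affineSpan ℝ {A, B}) :
    inner ℝ (incenter A B C - A) (B - A) ∈ Set.Ioo 0 (dist A B ^ 2) := by
  have hc : 0 < dist A B := dist_pos.2 hAB
  have hBC : dist B C < dist B A + dist A C := by
    refine dist_lt_dist_add_dist_iff.2 fun h => hC ?_
    rw [Set.pair_comm]
    exact h.right_mem_affineSpan_of_left_ne hAB.symm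
  have hAC : dist A C < dist A B + dist B C :=
    dist_lt_dist_add_dist_iff.2 fun h => hC (h.right_mem_affineSpan_of_left_ne hAB)
  rw [dist_comm B A] at hBC
  rw [inner_incenter_sub C hAB, dist_comm C A]
  constructor <;> nlinarith

/-- If `C` and `D` lie strictly on opposite sides of the line through `A` and
`B`, then the segment joining the incenters of the triangles `ABC` and `ABD`
intersects the open segment between `A` and `B`. -/
theorem incenter_segment_intersects_common_edge
    (A B C D : EuclideanSpace ℝ (Fin 2)) (hAB : A ≠ B)
    (hABC : AffineIndependent ℝ ![A, B, C])
    (hABD : AffineIndependent ℝ ![A, B, D])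
    (hopp : (affineSpan ℝ {A, B}).SOppSide C D) :
    ∃ p : EuclideanSpace ℝ (Fin 2),
      p ∈ segment ℝ (incenter A B C) (incenter A B D) ∧
      p ∈ openSegment ℝ A B := by
  have hI : (affineSpan ℝ {A, B}).SOppSide (incenter A B C) (incenter A B D) :=
    ((sSameSide_incenter hAB hopp.2.1).symm.trans_sOppSide hopp).trans_sSameSide
      (sSameSide_incenter hAB hopp.2.2)
  obtain ⟨p, hp, hbtw⟩ := AffineSubspace.wOppSide_iff_exists_wbtw.1 hI.wOppSide
  have hseg : p ∈ segment ℝ (incenter A B C) (incenter A B D) := mem_segment_iff_wbtw.2 hbtw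
  refine ⟨p, hseg, ?_⟩
  have hconv : Convex ℝ {x : EuclideanSpace ℝ (Fin 2) |
      inner ℝ (x - A) (B - A) ∈ Set.Ioo 0 (dist A B ^ 2)} := by
    intro x hx y hy a b ha hb hab
    have hlin : inner ℝ (a • x + b • y - A) (B - A) =
        a • inner ℝ (x - A) (B - A) + b • inner ℝ (y - A) (B - A) := by
      have hsub : a • x + b • y - A = a • (x - A) + b • (y - A) := by
        rw [← eq_sub_iff_add_eq'] at hab
        subst hab
        module
      rw [hsub, inner_add_left, real_inner_smul_left, real_inner_smul_left, smul_eq_mul,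
        smul_eq_mul]
    rw [Set.mem_ofPred_eq, hlin]
    exact convex_Ioo (𝕜 := ℝ) _ _ hx hy ha hb hab
  have hpr := hconv.segment_subset (inner_incenter_sub_mem_Ioo hAB hopp.2.1)
    (inner_incenter_sub_mem_Ioo hAB hopp.2.2) hseg
  obtain ⟨r, rfl⟩ := mem_affineSpan_pair_iff_exists_lineMap_eq.1 hp
  have hc : 0 < dist A B ^ 2 := pow_pos (dist_pos.2 hAB) 2
  have hr : inner ℝ (AffineMap.lineMap A B r - A) (B - A) = r * dist A B ^ 2 := by
    rw [AffineMap.lineMap_apply, vsub_eq_sub, vadd_eq_add, add_sub_cancel_right,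
      real_inner_smul_left, real_inner_self_eq_norm_sq, dist_comm, dist_eq_norm]
  rw [Set.mem_ofPred_eq, hr] at hpr
  rw [openSegment_eq_image_lineMap]
  exact ⟨r, ⟨pos_of_mul_pos_left hpr.1 hc.le, by nlinarith [hpr.2]⟩, rfl⟩
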